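/- Suppose f ∈ L²(ℝ) is phase-space localized with tolerance δ₁. Then for every integer m ≥ 1, ‖f⁻ₘ − Pₘ f⁻ₘ₋₁‖_{L²} ≤ (m+2)·(3 + 15·kmax/(4·2^m))·δ₁·‖f‖_{L²}. -/

import Mathlib

open MeasureTheory Real Complex Set Function
open scoped ENNReal

noncomputable section

/-- The error function `erf x = (2/√π) ∫₀ˣ e^{-t²} dt`. -/
def erf' (x : ℝ) : ℝ := (2 / Real.sqrt Real.pi) * ∫ t in (0:ℝ)..x, Real.exp (-t^2)

/-- The complementary error function `erfc x = 1 - erf x`. -/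
def erfc' (x : ℝ) : ℝ := 1 - erf' x

/-- The inverse of the strictly decreasing bijection `erfc' : [0,∞) → (0,1]`. -/
def erfcInv (y : ℝ) : ℝ := Function.invFunOn erfc' (Set.Ici 0) y

/-- The spatial cutoff χ₀(x) = (1/2)[erf((x+3L/4)/σ) − erf((x−3L/4)/σ)]. -/
def chi0 (L σ x : ℝ) : ℝ := (1/2) * (erf' ((x + 3*L/4)/σ) - erf' ((x - 3*L/4)/σ))

/-- The frequency cutoff P₀(k) = (1/2)[erf(σ(k+3kmax/8)) − erf(σ(k−3kmax/8))]. -/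
def P0fun (kmax σ k : ℝ) : ℝ := (1/2) * (erf' (σ*(k + 3*kmax/8)) - erf' (σ*(k - 3*kmax/8)))

/-- The scaled spatial cutoff χₘ(x) = χ₀(2^{-m} x). -/
def chiSc (L σ : ℝ) (m : ℕ) (x : ℝ) : ℝ := chi0 L σ (x / 2^m)

/-- The scaled frequency cutoff Pₘ(k) = P₀(2^m k). -/
def PSc (kmax σ : ℝ) (m : ℕ) (k : ℝ) : ℝ := P0fun kmax σ (2^m * k)

/-- Fourier transform with the convention f̂(k) = (2π)^{-1/2} ∫ f(x) e^{-ikx} dx. -/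
def ft (f : ℝ → ℂ) (k : ℝ) : ℂ :=
  (Real.sqrt (2*Real.pi) : ℂ)⁻¹ * ∫ x : ℝ, Complex.exp (-(Complex.I * k * x)) * f x

/-- Inverse Fourier transform with the convention (2π)^{-1/2} ∫ g(k) e^{ikx} dk. -/
def ift (g : ℝ → ℂ) (x : ℝ) : ℂ :=
  (Real.sqrt (2*Real.pi) : ℂ)⁻¹ * ∫ k : ℝ, Complex.exp (Complex.I * k * x) * g k

/-- The space L²(ℝ, ℂ). -/
abbrev L2 := Lp ℂ 2 (volume : Measure ℝ)

/-- `T` is the bounded Fourier multiplier operator on L² with symbol `m`: on the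
dense set of `f ∈ L¹ ∩ L²` with integrable Fourier transform, `T f = 𝓕⁻¹(m·𝓕f)`.
(This uniquely determines `T` for a bounded symbol.) -/
def IsMultOp (m : ℝ → ℝ) (T : L2 →L[ℂ] L2) : Prop :=
  ∀ f : L2, Integrable (f : ℝ → ℂ) volume → Integrable (ft (f : ℝ → ℂ)) volume →
    (T f : ℝ → ℂ) =ᵐ[volume] ift (fun k => (m k : ℂ) * ft (f : ℝ → ℂ) k)

/-- `T` is the operator of pointwise multiplication by the real function `c`. -/
def IsMulBy (c : ℝ → ℝ) (T : L2 →L[ℂ] L2) : Prop :=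
  ∀ f : L2, (T f : ℝ → ℂ) =ᵐ[volume] fun x => (c x : ℂ) * f x

theorem erf'_eq (a x : ℝ) : (2 / √Real.pi) * (∫ t in a..x, Real.exp (-t ^ 2)) = erf' x - erf' a := by
  have h : ∀ u v : ℝ, IntervalIntegrable (fun t : ℝ => Real.exp (-t ^ 2)) volume u v :=
    fun u v => (by fun_prop : Continuous fun t : ℝ => Real.exp (-t ^ 2)).intervalIntegrable _ _
  rw [erf', erf', ← mul_sub, intervalIntegral.integral_interval_sub_left (h _ _) (h _ _)]

theorem integrable_exp_neg_sq : Integrable fun t : ℝ => Real.exp (-t ^ 2) := by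
  simpa using integrable_exp_neg_mul_sq one_pos

theorem erfc'_eq_integral_Ioi (u : ℝ) :
    erfc' u = (2 / √Real.pi) * ∫ t in Ioi u, Real.exp (-t ^ 2) := by
  have h0 : ∫ t in Ioi (0 : ℝ), Real.exp (-t ^ 2) = √Real.pi / 2 := by
    simpa using integral_gaussian_Ioi 1
  have h1 := intervalIntegral.integral_Ioi_sub_Ioi' (μ := volume) (a := 0) (b := u)
    integrable_exp_neg_sq.integrableOn integrable_exp_neg_sq.integrableOn
  have hpi : √Real.pi ≠ 0 := (Real.sqrt_pos.2 Real.pi_pos).ne'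
  rw [erfc', erf', ← h1, h0]
  field_simp
  ring

theorem erf'_neg (x : ℝ) : erf' (-x) = -erf' x := by
  have h := intervalIntegral.integral_comp_neg (a := 0) (b := x) fun t : ℝ => Real.exp (-t ^ 2)
  simp only [neg_sq, neg_zero] at h
  rw [erf', erf', h, intervalIntegral.integral_symm (-x) 0]
  ring

theorem hasDerivAt_erf' (x : ℝ) : HasDerivAt erf' ((2 / √Real.pi) * Real.exp (-x ^ 2)) x := by
  have hc : Continuous fun t : ℝ => Real.exp (-t ^ 2) := by fun_prop
  exact (intervalIntegral.integral_hasDerivAt_right (hc.intervalIntegrable _ _)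
    (hc.stronglyMeasurableAtFilter _ _) hc.continuousAt).const_mul _

theorem contDiff_erf' {n : ℕ∞} : ContDiff ℝ n erf' := by
  refine ContDiff.of_le (n := ((⊤ : ℕ∞) : WithTop ℕ∞)) ?_ (by exact_mod_cast le_top)
  rw [contDiff_infty_iff_deriv]
  refine ⟨fun x => (hasDerivAt_erf' x).differentiableAt, ?_⟩
  rw [funext fun x => (hasDerivAt_erf' x).deriv]
  fun_prop

theorem continuous_erf' : Continuous erf' := contDiff_erf' (n := 0) |>.continuous

theorem strictMono_erf' : StrictMono erf' :=
  strictMono_of_deriv_pos fun x => by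
    rw [(hasDerivAt_erf' x).deriv]
    have := Real.sqrt_pos.2 Real.pi_pos
    positivity

theorem erfc'_nonneg (u : ℝ) : 0 ≤ erfc' u := by
  rw [erfc'_eq_integral_Ioi]
  exact mul_nonneg (by positivity) (integral_nonneg fun t => (Real.exp_pos _).le)

theorem half_erfc'_le {μ : ℝ} (hμ : 0 ≤ μ) (u : ℝ) :
    erfc' u / 2 ≤ Real.exp (-μ * u + μ ^ 2 / 4) := by
  have hs := Real.sqrt_pos.2 Real.pi_pos
  have hi : Integrable fun t : ℝ => Real.exp (-(t - μ / 2) ^ 2) :=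
    integrable_exp_neg_sq.comp_sub_right (μ / 2)
  have hg : ∫ t : ℝ, Real.exp (-(t - μ / 2) ^ 2) = √Real.pi := by
    rw [integral_sub_right_eq_self (fun t : ℝ => Real.exp (-t ^ 2)) (μ / 2)]
    simpa using integral_gaussian 1
  have h : ∫ t in Ioi u, Real.exp (-t ^ 2) ≤ Real.exp (-μ * u + μ ^ 2 / 4) * √Real.pi := by
    calc ∫ t in Ioi u, Real.exp (-t ^ 2)
        ≤ ∫ t in Ioi u, Real.exp (-μ * u + μ ^ 2 / 4) * Real.exp (-(t - μ / 2) ^ 2) := by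
          refine setIntegral_mono_on integrable_exp_neg_sq.integrableOn
            (hi.const_mul _).integrableOn measurableSet_Ioi fun t ht => ?_
          rw [← Real.exp_add, Real.exp_le_exp]
          nlinarith [mul_le_mul_of_nonneg_left (le_of_lt (mem_Ioi.1 ht)) hμ]
      _ ≤ ∫ t, Real.exp (-μ * u + μ ^ 2 / 4) * Real.exp (-(t - μ / 2) ^ 2) :=
          setIntegral_le_integral (hi.const_mul _) (Filter.Eventually.of_forall fun t => by positivity)
      _ = _ := by rw [integral_const_mul, hg]
  rw [erfc'_eq_integral_Ioi, div_mul_eq_mul_div, div_div, div_le_iff₀ (by positivity)]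
  linarith

theorem half_erfc'_div_le {l σ : ℝ} (hl : 0 ≤ l) (hσ : 0 < σ) (w : ℝ) :
    erfc' (w / σ) / 2 ≤ Real.exp (-l * w + l ^ 2 * σ ^ 2 / 4) := by
  refine (half_erfc'_le (mul_nonneg hl hσ.le) _).trans_eq ?_
  congr 1
  field_simp

theorem tendsto_erfc' : Filter.Tendsto erfc' Filter.atTop (nhds 0) := by
  have h : Filter.Tendsto (fun u : ℝ => 2 * Real.exp (-1 * u + 1 ^ 2 / 4)) Filter.atTop
      (nhds (2 * 0)) :=
    ((Real.tendsto_exp_atBot.comp (Filter.tendsto_atBot_add_const_right _ _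
      (Filter.tendsto_id.const_mul_atTop_of_neg (by norm_num)))).const_mul 2)
  rw [mul_zero] at h
  exact squeeze_zero erfc'_nonneg (fun u => by linarith [half_erfc'_le zero_le_one u]) h

theorem erfc'_zero : erfc' 0 = 1 := by simp [erfc', erf']

theorem erfc'_erfcInv {y : ℝ} (h0 : 0 < y) (h1 : y ≤ 1) : erfc' (erfcInv y) = y := by
  obtain ⟨b, hb, hb0⟩ := ((tendsto_erfc'.eventually (gt_mem_nhds h0)).and
    (Filter.eventually_ge_atTop 0)).exists
  have hc : ContinuousOn erfc' (Icc 0 b) := (continuous_const.sub continuous_erf').continuousOn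
  obtain ⟨x, hx, hxy⟩ := intermediate_value_Icc' hb0 hc ⟨hb.le, erfc'_zero.symm ▸ h1⟩
  exact Function.invFunOn_eq ⟨x, hx.1, hxy⟩

theorem erfc'_one_le_one : erfc' 1 ≤ 1 := by
  have := strictMono_erf' zero_lt_one
  have h := erfc'_zero
  rw [erfc'] at h ⊢
  linarith

theorem one_le_erfcInv {y : ℝ} (h0 : 0 < y) (h1 : y ≤ erfc' 1) : 1 ≤ erfcInv y := by
  have h := erfc'_erfcInv h0 (h1.trans erfc'_one_le_one)
  by_contra! hc
  have := strictMono_erf' hc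
  simp only [erfc'] at h h1
  linarith

theorem le_erfc' (c : ℝ) :
    (2 / √Real.pi) * (Real.exp (-c ^ 2) * (c / (2 * c ^ 2 + 1))) ≤ erfc' c := by
  have hd : ∀ t : ℝ, HasDerivAt (fun t : ℝ => erf' t +
      (2 / √Real.pi) * (Real.exp (-t ^ 2) * (t / (2 * t ^ 2 + 1))))
      ((2 / √Real.pi) * (2 * Real.exp (-t ^ 2) / (2 * t ^ 2 + 1) ^ 2)) t := fun t => by
    have hne : 2 * t ^ 2 + 1 ≠ 0 := by positivity
    have h1 : HasDerivAt (fun t : ℝ => Real.exp (-t ^ 2)) (Real.exp (-t ^ 2) * (-(2 * t))) t := by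
      simpa using ((hasDerivAt_pow 2 t).neg).exp
    have h2 : HasDerivAt (fun t : ℝ => 2 * t ^ 2 + 1) (2 * (2 * t)) t := by
      simpa using ((hasDerivAt_pow 2 t).const_mul 2).add_const 1
    refine ((hasDerivAt_erf' t).add
      ((h1.mul ((hasDerivAt_id t).div h2 hne)).const_mul _)).congr_deriv ?_
    simp only [Pi.div_apply, id]
    field_simp
    ring
  have hm := monotone_of_deriv_nonneg (fun t => (hd t).differentiableAt) fun t => by
    rw [(hd t).deriv]; positivity
  have hlim : Filter.Tendsto (fun t : ℝ => erfc' t -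
      (2 / √Real.pi) * (Real.exp (-t ^ 2) * (t / (2 * t ^ 2 + 1)))) Filter.atTop (nhds 0) := by
    have h3 : Filter.Tendsto (fun t : ℝ => Real.exp (-t)) Filter.atTop (nhds 0) :=
      Real.tendsto_exp_neg_atTop_nhds_zero
    have h4 : Filter.Tendsto (fun t : ℝ => Real.exp (-t ^ 2) * (t / (2 * t ^ 2 + 1)))
        Filter.atTop (nhds 0) := by
      refine squeeze_zero' ?_ ?_ h3
      · filter_upwards [Filter.eventually_ge_atTop 0] with t ht
        positivity
      · filter_upwards [Filter.eventually_ge_atTop 1] with t ht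
        have : t / (2 * t ^ 2 + 1) ≤ 1 := by
          rw [div_le_one (by positivity)]; nlinarith
        calc _ ≤ Real.exp (-t ^ 2) * 1 := by gcongr
          _ ≤ _ := by rw [mul_one, Real.exp_le_exp]; nlinarith
    simpa using tendsto_erfc'.sub (h4.const_mul (2 / √Real.pi))
  refine sub_nonneg.1 (le_of_tendsto hlim ((Filter.eventually_ge_atTop c).mono fun t ht => ?_))
  have := hm ht
  simp only [erfc'] at this ⊢
  linarith

theorem exp_bound_le_erfc' {c : ℝ} (hc : 1 ≤ c) :
    4 * Real.exp (-7 * c ^ 2) + 2 * Real.exp (-(27 / 16) * c ^ 2) ≤ 3 * erfc' c := by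
  have hs := Real.sqrt_pos.2 Real.pi_pos
  have hc0 : 0 < c := by linarith
  have hce : c ≤ Real.exp ((c ^ 2 - 1) / 2) := by
    have := Real.add_one_le_exp ((c ^ 2 - 1) / 2)
    nlinarith [sq_nonneg (c - 1)]
  have hsq : √Real.pi ≤ 1.7725 := by
    rw [Real.sqrt_le_left (by norm_num)]
    linarith [Real.pi_lt_d4, show (3.1416 : ℝ) ≤ 1.7725 ^ 2 by norm_num]
  have key : c * (2 * Real.exp (-(11 / 16) * c ^ 2) + 4 * Real.exp (-6 * c ^ 2)) ≤ 2 / √Real.pi := by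
    have h1 : c * Real.exp (-(11 / 16) * c ^ 2) ≤ Real.exp (-(11 / 16)) :=
      calc _ ≤ Real.exp ((c ^ 2 - 1) / 2) * Real.exp (-(11 / 16) * c ^ 2) := by gcongr
        _ ≤ _ := by rw [← Real.exp_add, Real.exp_le_exp]; nlinarith
    have h2 : c * Real.exp (-6 * c ^ 2) ≤ Real.exp (-6) :=
      calc _ ≤ Real.exp ((c ^ 2 - 1) / 2) * Real.exp (-6 * c ^ 2) := by gcongr
        _ ≤ _ := by rw [← Real.exp_add, Real.exp_le_exp]; nlinarith
    have h3 : Real.exp (-(11 / 16)) ≤ 1 / 1.98 := by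
      rw [Real.exp_neg, inv_eq_one_div]
      refine one_div_le_one_div_of_le (by norm_num) ?_
      refine le_trans ?_ (Real.sum_le_exp_of_nonneg (by norm_num : (0 : ℝ) ≤ 11 / 16) 5)
      norm_num [Finset.sum_range_succ, Nat.factorial]
    have h4 : Real.exp (-6) ≤ 1 / 64 := by
      rw [Real.exp_neg, inv_eq_one_div]
      refine one_div_le_one_div_of_le (by norm_num) ?_
      have : (2 : ℝ) ^ 6 ≤ Real.exp 1 ^ 6 := by
        gcongr
        linarith [Real.add_one_le_exp 1]
      rw [← Real.exp_nat_mul] at this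
      norm_num at this ⊢
      exact this
    have h5 : 2 / 1.7725 ≤ 2 / √Real.pi := by gcongr
    calc _ = 2 * (c * Real.exp (-(11 / 16) * c ^ 2)) + 4 * (c * Real.exp (-6 * c ^ 2)) := by ring
      _ ≤ 2 * (1 / 1.98) + 4 * (1 / 64) := by linarith
      _ ≤ 2 / 1.7725 := by norm_num
      _ ≤ _ := h5
  have hq : (1 : ℝ) / 3 ≤ c * (c / (2 * c ^ 2 + 1)) := by
    rw [mul_div_assoc', div_le_div_iff₀ (by norm_num) (by positivity)]
    nlinarith
  have e1 : Real.exp (-7 * c ^ 2) = Real.exp (-c ^ 2) * Real.exp (-6 * c ^ 2) := by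
    rw [← Real.exp_add]; ring_nf
  have e2 : Real.exp (-(27 / 16) * c ^ 2) = Real.exp (-c ^ 2) * Real.exp (-(11 / 16) * c ^ 2) := by
    rw [← Real.exp_add]; ring_nf
  have hlow := le_erfc' c
  refine le_of_mul_le_mul_left ?_ hc0
  calc c * (4 * Real.exp (-7 * c ^ 2) + 2 * Real.exp (-(27 / 16) * c ^ 2))
      = Real.exp (-c ^ 2) * (c * (2 * Real.exp (-(11 / 16) * c ^ 2) + 4 * Real.exp (-6 * c ^ 2))) := by
        rw [e1, e2]; ring
    _ ≤ Real.exp (-c ^ 2) * (2 / √Real.pi) := by gcongr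
    _ ≤ 3 * ((2 / √Real.pi) * Real.exp (-c ^ 2)) * (c * (c / (2 * c ^ 2 + 1))) := by
        have : 0 ≤ (2 / √Real.pi) * Real.exp (-c ^ 2) := by positivity
        nlinarith
    _ = c * (3 * ((2 / √Real.pi) * (Real.exp (-c ^ 2) * (c / (2 * c ^ 2 + 1))))) := by ring
    _ ≤ c * (3 * erfc' c) := by gcongr

theorem one_sub_chi0_eq (L σ x : ℝ) :
    1 - chi0 L σ x = erfc' ((3 * L / 4 - x) / σ) / 2 + erfc' ((3 * L / 4 + x) / σ) / 2 := by
  have h : (x - 3 * L / 4) / σ = -((3 * L / 4 - x) / σ) := by ring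
  rw [chi0, h, erf'_neg, erfc', erfc', add_comm x]
  ring

theorem chi0_neg (L σ x : ℝ) : chi0 L σ (-x) = chi0 L σ x := by
  have h1 : (-x + 3 * L / 4) / σ = -((x - 3 * L / 4) / σ) := by ring
  have h2 : (-x - 3 * L / 4) / σ = -((x + 3 * L / 4) / σ) := by ring
  rw [chi0, chi0, h1, h2, erf'_neg, erf'_neg]
  ring

theorem chi0_le_one (L σ x : ℝ) : chi0 L σ x ≤ 1 := by
  have := one_sub_chi0_eq L σ x
  linarith [erfc'_nonneg ((3 * L / 4 - x) / σ), erfc'_nonneg ((3 * L / 4 + x) / σ)]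

theorem chi0_nonneg {L σ : ℝ} (hL : 0 ≤ L) (hσ : 0 < σ) (x : ℝ) : 0 ≤ chi0 L σ x := by
  have : erf' ((x - 3 * L / 4) / σ) ≤ erf' ((x + 3 * L / 4) / σ) :=
    strictMono_erf'.monotone (by gcongr; linarith)
  rw [chi0]
  linarith

theorem contDiff_chi0 (L σ : ℝ) {n : ℕ∞} : ContDiff ℝ n (chi0 L σ) := by
  unfold chi0
  exact contDiff_const.mul ((contDiff_erf'.comp (by fun_prop)).sub (contDiff_erf'.comp (by fun_prop)))

theorem one_sub_chi0_le {L σ l : ℝ} (hσ : 0 < σ) (hl : 0 ≤ l) (x : ℝ) :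
    1 - chi0 L σ x ≤ Real.exp (-3 * l * L / 4 + l ^ 2 * σ ^ 2 / 4) *
      (Real.exp (l * x) + Real.exp (-l * x)) := by
  rw [one_sub_chi0_eq, mul_add, ← Real.exp_add, ← Real.exp_add]
  refine add_le_add ((half_erfc'_div_le hl hσ _).trans_eq ?_)
    ((half_erfc'_div_le hl hσ _).trans_eq ?_) <;> ring_nf

theorem chi0_le {L σ l : ℝ} (hσ : 0 < σ) (hl : 0 ≤ l) (x : ℝ) :
    chi0 L σ x ≤ Real.exp (3 * l * L / 4 + l ^ 2 * σ ^ 2 / 4) * Real.exp (-l * x) := by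
  have h := half_erfc'_div_le hl hσ (x - 3 * L / 4)
  have h2 := erfc'_nonneg ((x + 3 * L / 4) / σ)
  rw [← Real.exp_add]
  calc chi0 L σ x ≤ erfc' ((x - 3 * L / 4) / σ) / 2 := by
        rw [chi0]; rw [erfc'] at h2 ⊢; linarith
    _ ≤ _ := h.trans_eq (by ring_nf)

theorem chi0_le' {L σ l : ℝ} (hσ : 0 < σ) (hl : 0 ≤ l) (x : ℝ) :
    chi0 L σ x ≤ Real.exp (3 * l * L / 4 + l ^ 2 * σ ^ 2 / 4) * Real.exp (l * x) := by
  simpa [chi0_neg] using chi0_le (L := L) hσ hl (-x)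

theorem one_sub_chi0_mul_chi0_le {L σ L' σ' l : ℝ} (hL' : 0 ≤ L') (hσ : 0 < σ) (hσ' : 0 < σ')
    (hl : 0 ≤ l) (x : ℝ) :
    (1 - chi0 L σ x) * chi0 L' σ' x ≤
      2 * Real.exp (-3 * l * (L - L') / 4 + l ^ 2 * (σ ^ 2 + σ' ^ 2) / 4) := by
  set A := Real.exp (-3 * l * L / 4 + l ^ 2 * σ ^ 2 / 4)
  set B := Real.exp (3 * l * L' / 4 + l ^ 2 * σ' ^ 2 / 4)
  have hA : 0 < A := Real.exp_pos _
  have hAB : Real.exp (-3 * l * (L - L') / 4 + l ^ 2 * (σ ^ 2 + σ' ^ 2) / 4) = A * B := by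
    rw [← Real.exp_add]; ring_nf
  have hinv : Real.exp (l * x) * Real.exp (-l * x) = 1 := by
    rw [← Real.exp_add]; simp
  have h0 := chi0_nonneg hL' hσ' x
  calc (1 - chi0 L σ x) * chi0 L' σ' x
      ≤ (A * (Real.exp (l * x) + Real.exp (-l * x))) * chi0 L' σ' x := by
        gcongr; exact one_sub_chi0_le hσ hl x
    _ = A * (Real.exp (l * x) * chi0 L' σ' x + Real.exp (-l * x) * chi0 L' σ' x) := by ring
    _ ≤ A * (Real.exp (l * x) * (B * Real.exp (-l * x)) +
          Real.exp (-l * x) * (B * Real.exp (l * x))) := by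
        gcongr
        · exact chi0_le hσ' hl x
        · exact chi0_le' hσ' hl x
    _ = 2 * (A * B) * (Real.exp (l * x) * Real.exp (-l * x)) := by ring
    _ = _ := by rw [hinv, hAB, mul_one]

theorem chiSc_eq (L σ : ℝ) (m : ℕ) : chiSc L σ m = chi0 (2 ^ m * L) (2 ^ m * σ) := by
  ext x
  have h : (2 : ℝ) ^ m ≠ 0 := by positivity
  rw [chiSc, chi0, chi0]
  congr 3 <;> field_simp

theorem PSc_eq (kmax σ : ℝ) (m : ℕ) : PSc kmax σ m = P0fun (kmax / 2 ^ m) (2 ^ m * σ) := by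
  ext x
  have h : (2 : ℝ) ^ m ≠ 0 := by positivity
  rw [PSc, P0fun, P0fun]
  congr 3 <;> field_simp

theorem P0fun_eq_chi0 (kmax : ℝ) {σ : ℝ} (hσ : σ ≠ 0) :
    P0fun kmax σ = chi0 (kmax / 2) σ⁻¹ := by
  ext k
  rw [P0fun, chi0]
  congr 3 <;> field_simp <;> ring

/-- The symbol `P0fun` translated by `l` in the imaginary direction. -/
def shiftedSymbol (kmax σ l : ℝ) (k : ℝ) : ℂ :=
  (σ / √Real.pi : ℝ) * ∫ s in (-(3 * kmax / 8))..(3 * kmax / 8),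
    Complex.exp (-(σ : ℂ) ^ 2 * (k - s + l * Complex.I) ^ 2)

theorem P0fun_eq_integral (kmax : ℝ) {σ : ℝ} (hσ : 0 < σ) (k : ℝ) :
    P0fun kmax σ k = σ / √Real.pi * ∫ s in (-(3 * kmax / 8))..(3 * kmax / 8),
      Real.exp (-σ ^ 2 * (k - s) ^ 2) := by
  have h := intervalIntegral.integral_comp_sub_mul (a := -(3 * kmax / 8)) (b := 3 * kmax / 8)
    (fun t : ℝ => Real.exp (-t ^ 2)) hσ.ne' (σ * k)
  have e : (fun s : ℝ => Real.exp (-(σ * k - σ * s) ^ 2)) =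
      fun s => Real.exp (-σ ^ 2 * (k - s) ^ 2) := by ext s; ring_nf
  have h2 := erf'_eq (σ * k - σ * (3 * kmax / 8)) (σ * k - σ * -(3 * kmax / 8))
  rw [e, smul_eq_mul] at h
  rw [h, P0fun, show σ * (k + 3 * kmax / 8) = σ * k - σ * -(3 * kmax / 8) by ring,
    show σ * (k - 3 * kmax / 8) = σ * k - σ * (3 * kmax / 8) by ring, ← h2]
  field_simp

theorem shiftedSymbol_zero (kmax : ℝ) {σ : ℝ} (hσ : 0 < σ) (k : ℝ) :
    shiftedSymbol kmax σ 0 k = P0fun kmax σ k := by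
  rw [P0fun_eq_integral kmax hσ, shiftedSymbol, Complex.ofReal_mul, ← intervalIntegral.integral_ofReal]
  simp

theorem norm_shiftedSymbol_integrand (σ l k s : ℝ) :
    ‖Complex.exp (-(σ : ℂ) ^ 2 * (k - s + l * Complex.I) ^ 2)‖ =
      Real.exp (l ^ 2 * σ ^ 2) * Real.exp (-σ ^ 2 * (k - s) ^ 2) := by
  rw [Complex.norm_exp, ← Real.exp_add]
  congr 1
  have : -(σ : ℂ) ^ 2 * (k - s + l * Complex.I) ^ 2 =
      ((l ^ 2 * σ ^ 2 + -σ ^ 2 * (k - s) ^ 2 : ℝ) : ℂ) +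
        ((-2 * σ ^ 2 * (k - s) * l : ℝ) : ℂ) * Complex.I := by
    push_cast
    linear_combination (-(σ : ℂ) ^ 2 * l ^ 2) * Complex.I_sq
  rw [this]
  simp only [Complex.add_re, Complex.ofReal_re, Complex.re_ofReal_mul, Complex.I_re, mul_zero, add_zero]

theorem P0fun_nonneg {kmax σ : ℝ} (hk : 0 ≤ kmax) (hσ : 0 < σ) (k : ℝ) : 0 ≤ P0fun kmax σ k := by
  rw [P0fun_eq_chi0 _ hσ.ne']
  exact chi0_nonneg (by positivity) (by positivity) k

theorem P0fun_le_one (kmax : ℝ) {σ : ℝ} (hσ : 0 < σ) (k : ℝ) : P0fun kmax σ k ≤ 1 := by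
  rw [P0fun_eq_chi0 _ hσ.ne']
  exact chi0_le_one _ _ k

theorem continuous_P0fun (kmax σ : ℝ) : Continuous (P0fun kmax σ) := by
  unfold P0fun
  exact continuous_const.mul ((continuous_erf'.comp (by fun_prop)).sub
    (continuous_erf'.comp (by fun_prop)))

theorem norm_shiftedSymbol_le {kmax σ : ℝ} (hk : 0 ≤ kmax) (hσ : 0 < σ) (l k : ℝ) :
    ‖shiftedSymbol kmax σ l k‖ ≤ Real.exp (l ^ 2 * σ ^ 2) := by
  have hs := Real.sqrt_pos.2 Real.pi_pos
  rw [shiftedSymbol, norm_mul, Complex.norm_real, Real.norm_of_nonneg (by positivity)]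
  have h := intervalIntegral.norm_integral_le_integral_norm (μ := volume)
    (a := -(3 * kmax / 8)) (b := 3 * kmax / 8) (by linarith)
    (f := fun s : ℝ => Complex.exp (-(σ : ℂ) ^ 2 * (k - s + l * Complex.I) ^ 2))
  simp only [norm_shiftedSymbol_integrand, intervalIntegral.integral_const_mul] at h
  calc _ ≤ σ / √Real.pi * (Real.exp (l ^ 2 * σ ^ 2) *
        ∫ s in (-(3 * kmax / 8))..(3 * kmax / 8), Real.exp (-σ ^ 2 * (k - s) ^ 2)) := by gcongr
    _ = Real.exp (l ^ 2 * σ ^ 2) * P0fun kmax σ k := by rw [P0fun_eq_integral kmax hσ]; ring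
    _ ≤ Real.exp (l ^ 2 * σ ^ 2) * 1 := by gcongr; exact P0fun_le_one kmax hσ k
    _ = _ := mul_one _

theorem integrable_shiftedSymbol_integrand {σ : ℝ} (hσ : 0 < σ) (l a : ℝ) :
    Integrable (fun z : ℝ × ℝ => Complex.exp (-(σ : ℂ) ^ 2 * (z.1 - z.2 + l * Complex.I) ^ 2))
      (volume.prod (volume.restrict (Ioc (-a) a))) := by
  have h1 : Integrable (fun k : ℝ => Real.exp (-(σ ^ 2 / 2) * k ^ 2)) :=
    integrable_exp_neg_mul_sq (by positivity)
  have h2 : Integrable (fun s : ℝ => Real.exp (l ^ 2 * σ ^ 2) * Real.exp (σ ^ 2 * s ^ 2))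
      (volume.restrict (Ioc (-a) a)) :=
    (Continuous.integrableOn_Icc (by fun_prop)).mono_set Ioc_subset_Icc_self
  refine (h1.mul_prod h2).mono' (by fun_prop) (Filter.Eventually.of_forall fun z => ?_)
  rw [norm_shiftedSymbol_integrand, ← Real.exp_add, ← Real.exp_add, ← Real.exp_add, Real.exp_le_exp]
  nlinarith [mul_nonneg (sq_nonneg σ) (sq_nonneg (z.1 - 2 * z.2))]

theorem integrable_shiftedSymbol {kmax σ : ℝ} (hk : 0 ≤ kmax) (hσ : 0 < σ) (l : ℝ) :
    Integrable (shiftedSymbol kmax σ l) := by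
  unfold shiftedSymbol
  simp only [intervalIntegral.integral_of_le (show -(3 * kmax / 8) ≤ 3 * kmax / 8 by linarith)]
  exact (integrable_shiftedSymbol_integrand hσ l _).integral_prod_left.const_mul _

theorem integral_exp_mul_shiftedSymbol {kmax σ : ℝ} (hk : 0 ≤ kmax) (hσ : 0 < σ) (l z : ℝ) :
    ∫ k : ℝ, Complex.exp (Complex.I * z * k) * shiftedSymbol kmax σ l k =
      Complex.exp (l * z) * ∫ k : ℝ, Complex.exp (Complex.I * z * k) * shiftedSymbol kmax σ 0 k := by
  have hle : -(3 * kmax / 8) ≤ 3 * kmax / 8 := by linarith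
  have key : ∀ l : ℝ, ∫ k : ℝ, Complex.exp (Complex.I * z * k) * shiftedSymbol kmax σ l k =
      (σ / √Real.pi : ℝ) * ∫ s in Ioc (-(3 * kmax / 8)) (3 * kmax / 8),
        Complex.exp (l * z) * ((Real.pi / -(-(σ : ℂ) ^ 2)) ^ (1 / 2 : ℂ) *
          Complex.exp (-(z : ℂ) ^ 2 / (4 * σ ^ 2) + Complex.I * z * s)) := by
    intro l
    have hI : Integrable (fun w : ℝ × ℝ => Complex.exp (Complex.I * z * w.1) *
        Complex.exp (-(σ : ℂ) ^ 2 * (w.1 - w.2 + l * Complex.I) ^ 2))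
        (volume.prod (volume.restrict (Ioc (-(3 * kmax / 8)) (3 * kmax / 8)))) := by
      refine (integrable_shiftedSymbol_integrand hσ l _).bdd_mul (c := 1) (by fun_prop)
        (Filter.Eventually.of_forall fun w => ?_)
      rw [mul_assoc, ← Complex.ofReal_mul, mul_comm, Complex.norm_exp_ofReal_mul_I]
    unfold shiftedSymbol
    simp only [intervalIntegral.integral_of_le hle, mul_left_comm (Complex.exp _),
      ← integral_const_mul (Complex.exp (Complex.I * z * _))]
    rw [integral_const_mul, integral_integral_swap hI]
    congr 1
    refine integral_congr_ae (Filter.Eventually.of_forall fun s => ?_)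
    have hb : (-(σ : ℂ) ^ 2).re < 0 := by
      rw [← Complex.ofReal_pow, ← Complex.ofReal_neg, Complex.ofReal_re]
      have := sq_pos_of_pos hσ
      linarith
    have hσ' : (σ : ℂ) ≠ 0 := by exact_mod_cast hσ.ne'
    have := integral_cexp_quadratic hb (Complex.I * z + 2 * σ ^ 2 * (s - l * Complex.I))
      (-(σ : ℂ) ^ 2 * (s - l * Complex.I) ^ 2)
    simp only
    rw [← Complex.exp_add]
    refine (integral_congr_ae (Filter.Eventually.of_forall fun k => ?_)).trans (this.trans ?_)
    · rw [← Complex.exp_add]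
      ring_nf
    · congr 2
      field_simp
      linear_combination (z ^ 2 - 4 * (σ : ℂ) ^ 2 * l * z) * Complex.I_sq
  rw [key l, key 0, integral_const_mul]
  simp only [Complex.ofReal_zero, zero_mul, Complex.exp_zero, one_mul]
  ring

section Fourier

open FourierTransform

theorem integral_fourierInv_mul {f g : ℝ → ℂ} (hf : Integrable f) (hg : Integrable g) :
    ∫ x, 𝓕⁻ f x * g x = ∫ x, f x * 𝓕⁻ g x := by
  have h := VectorFourier.integral_fourierIntegral_smul_eq_flip (L := -innerₗ ℝ) (μ := volume)
    (ν := volume) Real.continuous_fourierChar (continuous_inner.neg) hf hg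
  simp only [smul_eq_mul] at h
  have e : (-innerₗ ℝ : ℝ →ₗ[ℝ] ℝ →ₗ[ℝ] ℝ).flip = -innerₗ ℝ := by
    ext
    simp
  rwa [e] at h

theorem continuous_fourierInv {f : ℝ → ℂ} (hf : Integrable f) : Continuous (𝓕⁻ f) :=
  VectorFourier.fourierIntegral_continuous Real.continuous_fourierChar
    (continuous_inner.neg) hf

theorem fourierInv_toLp_ae_eq {g : ℝ → ℂ} (h1 : Integrable g) (h2 : MemLp g 2) :
    (𝓕⁻ (h2.toLp g : L2) : L2) =ᵐ[volume] 𝓕⁻ g := by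
  refine ae_eq_of_integral_contDiff_smul_eq ((Lp.memLp _).locallyIntegrable (by norm_num))
    (continuous_fourierInv h1).locallyIntegrable fun u hu hc => ?_
  have hc' : HasCompactSupport (fun x => (u x : ℂ)) := hc.comp_left Complex.ofReal_zero
  let ψ : SchwartzMap ℝ ℂ := hc'.toSchwartzMap (Complex.ofRealCLM.contDiff.comp hu)
  have hψ : ∀ x, ψ x = (u x : ℂ) := fun x => rfl
  have key : Lp.toTemperedDistribution (𝓕⁻ (h2.toLp g : L2) : L2) ψ =
      Lp.toTemperedDistribution (h2.toLp g : L2) (𝓕⁻ ψ) := by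
    rw [← Lp.fourierInv_toTemperedDistribution_eq, TemperedDistribution.fourierInv_apply]
  rw [Lp.toTemperedDistribution_apply, Lp.toTemperedDistribution_apply] at key
  have e : ∫ x, (𝓕⁻ ψ) x • (h2.toLp g : L2) x = ∫ x, ψ x * 𝓕⁻ g x := by
    rw [← integral_fourierInv_mul ψ.integrable h1, ← SchwartzMap.fourierInv_coe]
    refine integral_congr_ae ?_
    filter_upwards [h2.coeFn_toLp] with x hx
    rw [hx, smul_eq_mul]
  rw [e] at key
  simpa only [hψ, smul_eq_mul, Complex.real_smul] using key

theorem exists_contDiff_hasCompactSupport_norm_sub_le (f : L2) {ε : ℝ} (hε : 0 < ε) :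
    ∃ (g : ℝ → ℂ) (hg : MemLp g 2 volume), ContDiff ℝ (⊤ : ℕ∞) g ∧ HasCompactSupport g ∧
      ‖f - hg.toLp g‖ ≤ ε := by
  obtain ⟨g, hg₁, hg₂, hg₃⟩ := MemLp.exist_eLpNorm_sub_le (by norm_num) (by norm_num) (Lp.memLp f) hε
  have hg : MemLp g 2 := hg₂.continuous.memLp_of_hasCompactSupport hg₁
  refine ⟨g, hg, hg₂, hg₁, ?_⟩
  have h := eLpNorm_congr_ae (p := 2) (((Filter.EventuallyEq.refl _ (f : ℝ → ℂ)).sub hg.coeFn_toLp))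
  rw [Lp.norm_def, eLpNorm_congr_ae (Lp.coeFn_sub _ _), h]
  exact ENNReal.toReal_le_of_le_ofReal hε.le hg₃

theorem ft_eq (f : ℝ → ℂ) (k : ℝ) : ft f k = (√(2 * Real.pi) : ℂ)⁻¹ * 𝓕 f (k / (2 * Real.pi)) := by
  have hpi : (Real.pi : ℂ) ≠ 0 := by exact_mod_cast Real.pi_ne_zero
  rw [ft, Real.fourier_real_eq_integral_exp_smul]
  congr 2
  ext x
  rw [smul_eq_mul]
  congr 2
  push_cast
  field_simp

theorem ift_mul_ft (p : ℝ → ℝ) (f : ℝ → ℂ) :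
    ift (fun k => (p k : ℂ) * ft f k) = 𝓕⁻ fun ξ => (p (2 * Real.pi * ξ) : ℂ) * 𝓕 f ξ := by
  ext x
  have hpi : (Real.pi : ℂ) ≠ 0 := by exact_mod_cast Real.pi_ne_zero
  have hs : (√(2 * Real.pi) : ℂ)⁻¹ * (√(2 * Real.pi) : ℂ)⁻¹ = (2 * Real.pi : ℂ)⁻¹ := by
    rw [← mul_inv, ← Complex.ofReal_mul, Real.mul_self_sqrt (by positivity)]
    push_cast
    rfl
  have h := Measure.integral_comp_div (fun ξ : ℝ => Complex.exp (2 * Real.pi * (ξ * x) * Complex.I) *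
    ((p (2 * Real.pi * ξ) : ℂ) * 𝓕 f ξ)) (2 * Real.pi)
  rw [abs_of_pos (by positivity)] at h
  rw [ift, Real.fourierInv_eq']
  have e : ∫ k : ℝ, Complex.exp (Complex.I * k * x) * ((p k : ℂ) * ft f k) =
      (√(2 * Real.pi) : ℂ)⁻¹ * ∫ k : ℝ, Complex.exp (2 * Real.pi * (↑(k / (2 * Real.pi)) * x) * Complex.I) *
        ((p (2 * Real.pi * (k / (2 * Real.pi))) : ℂ) * 𝓕 f (k / (2 * Real.pi))) := by
    rw [← integral_const_mul]
    congr 1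
    ext k
    rw [ft_eq, mul_div_cancel₀ k (by positivity : 2 * Real.pi ≠ 0)]
    push_cast
    rw [show (2 * Real.pi * (k / (2 * Real.pi) * x) * Complex.I : ℂ) = Complex.I * k * x by field_simp]
    ring
  rw [e, h, ← mul_assoc, hs]
  rw [Complex.real_smul]
  push_cast
  rw [inv_mul_cancel_left₀ (by simp)]
  congr 1
  ext ξ
  simp [mul_comm x]

theorem memLp_mul_fourier (φ : SchwartzMap ℝ ℂ) {r : ℝ → ℂ} (hr : AEStronglyMeasurable r)
    {C : ℝ}
    (hC : ∀ ξ, ‖r ξ‖ ≤ C) : MemLp (fun ξ => r ξ * 𝓕 (φ : ℝ → ℂ) ξ) 2 := by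
  rw [← SchwartzMap.fourier_coe]
  refine (((𝓕 φ).memLp 2).const_mul (C : ℂ)).of_le
    (hr.mul (𝓕 φ).continuous.aestronglyMeasurable) (Filter.Eventually.of_forall fun ξ => ?_)
  rw [Pi.mul_apply, norm_mul, norm_mul, Complex.norm_real]
  gcongr
  exact (hC ξ).trans (le_abs_self C)

theorem integrable_mul_fourier (φ : SchwartzMap ℝ ℂ) {r : ℝ → ℂ} (hr : AEStronglyMeasurable r)
    {C : ℝ}
    (hC : ∀ ξ, ‖r ξ‖ ≤ C) : Integrable (fun ξ => r ξ * 𝓕 (φ : ℝ → ℂ) ξ) := by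
  rw [← SchwartzMap.fourier_coe]
  exact (𝓕 φ).integrable.bdd_mul hr (Filter.Eventually.of_forall hC)

theorem IsMultOp.toLp_ae_eq {p : ℝ → ℝ} {T : L2 →L[ℂ] L2} (hT : IsMultOp p T)
    (φ : SchwartzMap ℝ ℂ) : T (φ.toLp 2) =ᵐ[volume]
      𝓕⁻ fun ξ => (p (2 * Real.pi * ξ) : ℂ) * 𝓕 (φ : ℝ → ℂ) ξ := by
  have hφ := φ.coeFn_toLp 2 volume
  have hft : ft (φ.toLp 2 : L2) = ft φ := by
    ext k
    rw [ft_eq, ft_eq, Real.fourier_congr_ae hφ]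
  have hint : Integrable (ft (φ : ℝ → ℂ)) := by
    rw [funext (ft_eq φ), ← SchwartzMap.fourier_coe]
    exact ((𝓕 φ).integrable.comp_div (by positivity)).const_mul _
  have h := hT (φ.toLp 2) (φ.integrable.congr hφ.symm) (by rwa [hft])
  rwa [hft, ift_mul_ft] at h

theorem IsMultOp.toLp_eq {p : ℝ → ℝ} {T : L2 →L[ℂ] L2} (hT : IsMultOp p T)
    (hp : Continuous p) {C : ℝ} (hC : ∀ k, |p k| ≤ C) (φ : SchwartzMap ℝ ℂ) :
    (𝓕 (T (φ.toLp 2)) : L2) =ᵐ[volume]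
      fun ξ => (p (2 * Real.pi * ξ) : ℂ) * (𝓕 (φ.toLp 2 : L2) : L2) ξ := by
  have hr : AEStronglyMeasurable fun ξ : ℝ => (p (2 * Real.pi * ξ) : ℂ) :=
    (by fun_prop : Continuous fun ξ : ℝ => (p (2 * Real.pi * ξ) : ℂ)).aestronglyMeasurable
  have hC' : ∀ ξ : ℝ, ‖(p (2 * Real.pi * ξ) : ℂ)‖ ≤ C := fun ξ => by
    rw [Complex.norm_real]
    exact hC _
  have h2 := memLp_mul_fourier φ hr hC'
  have h : T (φ.toLp 2) = 𝓕⁻ (h2.toLp _ : L2) :=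
    Lp.ext ((hT.toLp_ae_eq φ).trans (fourierInv_toLp_ae_eq (integrable_mul_fourier φ hr hC') h2).symm)
  rw [h, FourierTransform.fourier_fourierInv_eq, SchwartzMap.toLp_fourier_eq]
  filter_upwards [h2.coeFn_toLp, (𝓕 φ).coeFn_toLp 2 volume] with ξ h3 h4
  rw [h3, h4, SchwartzMap.fourier_coe]

theorem sq_norm_le_re_inner {W V : L2} {r : ℝ → ℝ} (h0 : ∀ x, 0 ≤ r x) (h1 : ∀ x, r x ≤ 1)
    (h : W =ᵐ[volume] fun x => (r x : ℂ) * V x) : ‖W‖ ^ 2 ≤ (inner ℂ W V).re := by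
  have hle : 0 ≤ (inner ℂ W (V - W)).re := by
    rw [L2.inner_def, ← RCLike.re_eq_complex_re, ← integral_re (L2.integrable_inner W (V - W))]
    refine integral_nonneg_of_ae ?_
    filter_upwards [h, Lp.coeFn_sub V W] with x hx hs
    rw [hs, Pi.sub_apply, hx]
    have e : V x - r x * V x = ((1 - r x : ℝ) : ℂ) * V x := by push_cast; ring
    rw [e, ← smul_eq_mul, ← smul_eq_mul, inner_smul_left, inner_smul_right, Complex.conj_ofReal,
      ← mul_assoc, ← Complex.ofReal_mul, RCLike.re_eq_complex_re, Complex.re_ofReal_mul,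
      ← RCLike.re_eq_complex_re, inner_self_eq_norm_sq]
    exact mul_nonneg (mul_nonneg (h0 x) (sub_nonneg.2 (h1 x))) (sq_nonneg _)
  rw [inner_sub_right, Complex.sub_re] at hle
  have := inner_self_eq_norm_sq (𝕜 := ℂ) W
  rw [RCLike.re_eq_complex_re] at this
  linarith

theorem IsMultOp.sq_norm_one_sub_le {p : ℝ → ℝ} {T : L2 →L[ℂ] L2} (hT : IsMultOp p T)
    (hp : Continuous p) (h0 : ∀ k, 0 ≤ p k) (h1 : ∀ k, p k ≤ 1) (f : L2) :
    ‖(1 - T) f‖ ^ 2 ≤ (inner ℂ ((1 - T) f) f).re := by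
  refine DenseRange.induction_on (p := fun f : L2 => ‖(1 - T) f‖ ^ 2 ≤ (inner ℂ ((1 - T) f) f).re)
    (SchwartzMap.denseRange_toLpCLM (E := ℝ) (F := ℂ) (p := 2) (by norm_num)) f
    (isClosed_le (by fun_prop) (by fun_prop)) fun φ => ?_
  rw [SchwartzMap.toLpCLM_apply, ← Lp.norm_fourier_eq, ← Lp.inner_fourier_eq]
  refine sq_norm_le_re_inner (r := fun ξ => 1 - p (2 * Real.pi * ξ)) (fun ξ => sub_nonneg.2 (h1 _))
    (fun ξ => sub_le_self _ (h0 _)) ?_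
  have e : (𝓕 ((1 - T) (φ.toLp 2)) : L2) = 𝓕 (φ.toLp 2 : L2) - 𝓕 (T (φ.toLp 2)) := by
    rw [sub_apply, one_apply_eq_self]
    exact map_sub (Lp.fourierTransformₗᵢ ℝ ℂ) _ _
  rw [e]
  filter_upwards [Lp.coeFn_sub (𝓕 (φ.toLp 2 : L2) : L2) (𝓕 (T (φ.toLp 2))),
    hT.toLp_eq hp (fun k => by rw [abs_of_nonneg (h0 k)]; exact h1 k) φ] with ξ h2 h3
  rw [h2, Pi.sub_apply, h3]
  push_cast
  ring

theorem fourierInv_mul_fourier {q φ : ℝ → ℂ} (hq : Integrable q) (hφ : Integrable φ) (x : ℝ) :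
    𝓕⁻ (fun ξ => q (2 * Real.pi * ξ) * 𝓕 φ ξ) x =
      (2 * Real.pi : ℂ)⁻¹ * ∫ y, φ y * ∫ k : ℝ, Complex.exp (Complex.I * (x - y : ℝ) * k) * q k := by
  have hpi : (0 : ℝ) < 2 * Real.pi := by positivity
  have hg : Integrable fun ξ : ℝ => Complex.exp (↑(2 * Real.pi * (ξ * x)) * Complex.I) *
      q (2 * Real.pi * ξ) :=
    (hq.comp_mul_left' hpi.ne').bdd_mul (c := 1) (by fun_prop)
      (Filter.Eventually.of_forall fun ξ => (Complex.norm_exp_ofReal_mul_I _).le)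
  have h := VectorFourier.integral_fourierIntegral_smul_eq_flip (L := innerₗ ℝ) (μ := volume)
    (ν := volume) Real.continuous_fourierChar continuous_inner hφ hg
  rw [flip_innerₗ] at h
  have e : ∀ y : ℝ, 𝓕 (fun ξ : ℝ => Complex.exp (↑(2 * Real.pi * (ξ * x)) * Complex.I) *
      q (2 * Real.pi * ξ)) y = (2 * Real.pi : ℂ)⁻¹ *
        ∫ k : ℝ, Complex.exp (Complex.I * (x - y : ℝ) * k) * q k := fun y => by
    have h := Measure.integral_comp_mul_left (fun k : ℝ => Complex.exp (Complex.I * (x - y : ℝ) * k) * q k)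
      (2 * Real.pi)
    rw [abs_of_pos (by positivity), Complex.real_smul] at h
    push_cast at h
    push_cast
    rw [mul_inv, ← mul_inv, ← h, Real.fourier_real_eq_integral_exp_smul]
    congr 1
    ext ξ
    rw [smul_eq_mul, ← mul_assoc, ← Complex.exp_add]
    push_cast
    ring_nf
  rw [Real.fourierInv_eq', ← integral_const_mul]
  calc _ = ∫ ξ, 𝓕 φ ξ • (Complex.exp (↑(2 * Real.pi * (ξ * x)) * Complex.I) *
        q (2 * Real.pi * ξ)) := by
        congr 1
        ext ξ
        rw [smul_eq_mul, smul_eq_mul, ← mul_assoc, mul_comm (𝓕 φ ξ)]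
        simp [mul_comm x]
    _ = _ := h
    _ = _ := by
        congr 1
        ext y
        rw [mul_left_comm, ← e]
        rfl

theorem exp_mul_fourierInv_mul_fourier {kmax σ : ℝ} (hk : 0 ≤ kmax) (hσ : 0 < σ) (l : ℝ)
    {φ ψ : ℝ → ℂ} (hφ : Integrable φ) (hψ : Integrable ψ)
    (h : ∀ y, ψ y = Complex.exp (l * y) * φ y) (x : ℝ) :
    Complex.exp (l * x) * 𝓕⁻ (fun ξ => (P0fun kmax σ (2 * Real.pi * ξ) : ℂ) * 𝓕 φ ξ) x =
      𝓕⁻ (fun ξ => shiftedSymbol kmax σ l (2 * Real.pi * ξ) * 𝓕 ψ ξ) x := by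
  simp only [← shiftedSymbol_zero kmax hσ]
  rw [fourierInv_mul_fourier (integrable_shiftedSymbol hk hσ 0) hφ,
    fourierInv_mul_fourier (integrable_shiftedSymbol hk hσ l) hψ, mul_left_comm,
    ← integral_const_mul (Complex.exp _)]
  congr 2
  ext y
  rw [integral_exp_mul_shiftedSymbol hk hσ l, h]
  have : Complex.exp (l * x) = Complex.exp (l * y) * Complex.exp (l * (x - y : ℝ)) := by
    rw [← Complex.exp_add]
    push_cast
    ring_nf
  rw [this]
  ring

theorem IsMultOp.exists_ae_eq_exp_mul {kmax σ : ℝ} (hk : 0 ≤ kmax) (hσ : 0 < σ) {T : L2 →L[ℂ] L2}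
    (hT : IsMultOp (P0fun kmax σ) T) (l : ℝ) (φ ψ : SchwartzMap ℝ ℂ)
    (h : ∀ y, ψ y = Complex.exp (l * y) * φ y) :
    ∃ U : L2, ‖U‖ ≤ Real.exp (l ^ 2 * σ ^ 2) * ‖(ψ.toLp 2 : L2)‖ ∧
      U =ᵐ[volume] fun x => Complex.exp (l * x) * T (φ.toLp 2) x := by
  have hpi : (0 : ℝ) < 2 * Real.pi := by positivity
  have hr := ((integrable_shiftedSymbol hk hσ l).comp_mul_left' hpi.ne').aestronglyMeasurable
  have hC : ∀ ξ : ℝ, ‖shiftedSymbol kmax σ l (2 * Real.pi * ξ)‖ ≤ Real.exp (l ^ 2 * σ ^ 2) :=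
    fun ξ => norm_shiftedSymbol_le hk hσ l _
  have h2 := memLp_mul_fourier ψ hr hC
  refine ⟨𝓕⁻ (h2.toLp _ : L2), ?_, ?_⟩
  · have e : ‖(𝓕⁻ (h2.toLp _ : L2) : L2)‖ = ‖(h2.toLp _ : L2)‖ :=
      (Lp.fourierTransformₗᵢ ℝ ℂ).symm.norm_map _
    have e' : ‖((𝓕 ψ).toLp 2 : L2)‖ = ‖(ψ.toLp 2 : L2)‖ := by
      rw [← SchwartzMap.toLp_fourier_eq, Lp.norm_fourier_eq]
    rw [e, ← e']
    refine Lp.norm_le_mul_norm_of_ae_le_mul ?_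
    filter_upwards [h2.coeFn_toLp, (𝓕 ψ).coeFn_toLp 2 volume] with ξ h3 h4
    rw [h3, h4, norm_mul, SchwartzMap.fourier_coe]
    gcongr
    exact hC ξ
  · filter_upwards [fourierInv_toLp_ae_eq (integrable_mul_fourier ψ hr hC) h2,
      hT.toLp_ae_eq φ] with x h3 h4
    rw [h3, h4, exp_mul_fourierInv_mul_fourier hk hσ l φ.integrable ψ.integrable h]

theorem norm_le_mul_norm_add_norm {f U V : L2} {A : ℝ} (hA : 0 ≤ A)
    (h : ∀ᵐ x, ‖f x‖ ≤ A * (‖U x‖ + ‖V x‖)) : ‖f‖ ≤ A * (‖U‖ + ‖V‖) := by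
  have hU := (Lp.memLp U).norm
  have hV := (Lp.memLp V).norm
  have h1 : ‖f‖ ≤ A * ‖hU.toLp _ + hV.toLp _‖ := by
    refine Lp.norm_le_mul_norm_of_ae_le_mul ?_
    filter_upwards [h, hU.coeFn_toLp, hV.coeFn_toLp, Lp.coeFn_add (hU.toLp _) (hV.toLp _)]
      with x h2 h3 h4 h5
    rw [h5, Pi.add_apply, h3, h4, Real.norm_of_nonneg (by positivity)]
    exact h2
  refine h1.trans (mul_le_mul_of_nonneg_left ((norm_add_le _ _).trans_eq ?_) hA)
  rw [Lp.norm_toLp, Lp.norm_toLp, eLpNorm_norm, eLpNorm_norm, ← Lp.norm_def, ← Lp.norm_def]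

theorem norm_one_sub_mul_multOp_mul_le {kmax σ L L' σ' l : ℝ} (hk : 0 ≤ kmax) (hσ : 0 < σ)
    (hL' : 0 ≤ L') (hσ' : 0 < σ') (hl : 0 ≤ l) {T X Y : L2 →L[ℂ] L2}
    (hT : IsMultOp (P0fun kmax σ) T) (hX : IsMulBy (chi0 L σ) X) (hY : IsMulBy (chi0 L' σ') Y)
    (f : L2) : ‖(1 - X) (T (Y f))‖ ≤
      2 * Real.exp (-3 * l * (L - L') / 4 + l ^ 2 * (5 * σ ^ 2 + σ' ^ 2) / 4) * ‖f‖ := by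
  set M := 2 * Real.exp (-3 * l * (L - L') / 4 + l ^ 2 * (5 * σ ^ 2 + σ' ^ 2) / 4) with hM
  suffices hd : ∀ (g : ℝ → ℂ) (hg : MemLp g 2 volume), ContDiff ℝ (⊤ : ℕ∞) g → HasCompactSupport g →
      ‖(1 - X) (T (Y (hg.toLp g)))‖ ≤ M * ‖hg.toLp g‖ by
    have hcl : IsClosed {f : L2 | ‖(1 - X) (T (Y f))‖ ≤ M * ‖f‖} :=
      isClosed_le (by fun_prop) (by fun_prop)
    refine hcl.closure_subset (Metric.mem_closure_iff.2 fun ε hε => ?_)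
    obtain ⟨g, hg, h1, h2, h3⟩ := exists_contDiff_hasCompactSupport_norm_sub_le f (half_pos hε)
    exact ⟨hg.toLp g, hd g hg h1 h2, by rw [dist_eq_norm]; linarith⟩
  intro g hg h1 h2
  have hs : ∀ s : ℝ, ∃ ψ : SchwartzMap ℝ ℂ,
      ∀ x, ψ x = Complex.exp (s * x) * (chi0 L' σ' x * g x) := fun s => by
    refine ⟨HasCompactSupport.toSchwartzMap
      (f := fun x : ℝ => Complex.exp (s * x) * (chi0 L' σ' x * g x)) ?_ ?_, fun x => rfl⟩
    · exact h2.mul_left.mul_left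
    · refine ContDiff.mul ?_ ((Complex.ofRealCLM.contDiff.comp (contDiff_chi0 L' σ')).mul h1)
      exact (contDiff_const.mul Complex.ofRealCLM.contDiff).cexp
  obtain ⟨φ, hφ⟩ := hs 0
  obtain ⟨ψ, hψ⟩ := hs l
  obtain ⟨θ, hθ⟩ := hs (-l)
  simp only [Complex.ofReal_zero, zero_mul, Complex.exp_zero, one_mul] at hφ
  have hYφ : Y (hg.toLp g) = φ.toLp 2 := by
    refine Lp.ext ?_
    filter_upwards [hY (hg.toLp g), hg.coeFn_toLp, φ.coeFn_toLp 2 volume] with x h3 h4 h5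
    rw [h3, h4, h5, hφ]
  obtain ⟨U, hU, hU'⟩ := hT.exists_ae_eq_exp_mul hk hσ l φ ψ fun y => by rw [hψ, hφ]
  obtain ⟨V, hV, hV'⟩ := hT.exists_ae_eq_exp_mul hk hσ (-l) φ θ fun y => by rw [hθ, hφ]
  set B := Real.exp (3 * l * L' / 4 + l ^ 2 * σ' ^ 2 / 4)
  have hinv : ∀ x, Real.exp (l * x) * Real.exp (-l * x) = 1 := fun x => by
    rw [← Real.exp_add]; simp
  have hnorm : ∀ s x : ℝ, ‖Complex.exp (s * x)‖ = Real.exp (s * x) := fun s x => by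
    rw [← Complex.ofReal_mul, Complex.norm_exp_ofReal]
  have hψB : ‖(ψ.toLp 2 : L2)‖ ≤ B * ‖hg.toLp g‖ := by
    refine Lp.norm_le_mul_norm_of_ae_le_mul ?_
    filter_upwards [hg.coeFn_toLp, ψ.coeFn_toLp 2 volume] with x h4 h5
    rw [h4, h5, hψ, norm_mul, norm_mul, hnorm, ← mul_assoc, Complex.norm_real,
      Real.norm_of_nonneg (chi0_nonneg hL' hσ' x)]
    gcongr
    calc _ ≤ Real.exp (l * x) * (B * Real.exp (-l * x)) := by gcongr; exact chi0_le hσ' hl x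
      _ = B * (Real.exp (l * x) * Real.exp (-l * x)) := by ring
      _ = B := by rw [hinv, mul_one]
  have hθB : ‖(θ.toLp 2 : L2)‖ ≤ B * ‖hg.toLp g‖ := by
    refine Lp.norm_le_mul_norm_of_ae_le_mul ?_
    filter_upwards [hg.coeFn_toLp, θ.coeFn_toLp 2 volume] with x h4 h5
    rw [h4, h5, hθ, norm_mul, norm_mul, hnorm, ← mul_assoc, Complex.norm_real,
      Real.norm_of_nonneg (chi0_nonneg hL' hσ' x)]
    gcongr
    calc _ ≤ Real.exp (-l * x) * (B * Real.exp (l * x)) := by gcongr; exact chi0_le' hσ' hl x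
      _ = B * (Real.exp (l * x) * Real.exp (-l * x)) := by ring
      _ = B := by rw [hinv, mul_one]
  set A := Real.exp (-3 * l * L / 4 + l ^ 2 * σ ^ 2 / 4)
  have hUV : ‖(1 - X) (T (Y (hg.toLp g)))‖ ≤ A * (‖U‖ + ‖V‖) := by
    refine norm_le_mul_norm_add_norm (Real.exp_pos _).le ?_
    rw [hYφ, sub_apply, one_apply_eq_self]
    filter_upwards [Lp.coeFn_sub (T (φ.toLp 2)) (X (T (φ.toLp 2))), hX (T (φ.toLp 2)), hU', hV']
      with x h3 h4 h5 h6
    have e : T (φ.toLp 2) x - chi0 L σ x * T (φ.toLp 2) x =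
      ((1 - chi0 L σ x : ℝ) : ℂ) * T (φ.toLp 2) x := by push_cast; ring
    rw [h3, Pi.sub_apply, h4, h5, h6, e, norm_mul, norm_mul, norm_mul, hnorm, hnorm, Complex.norm_real,
      Real.norm_of_nonneg (sub_nonneg.2 (chi0_le_one _ _ _)), ← add_mul, ← mul_assoc]
    gcongr
    exact one_sub_chi0_le hσ hl x
  have hAB : M = 2 * (A * Real.exp (l ^ 2 * σ ^ 2) * B) := by
    rw [hM, ← Real.exp_add, ← Real.exp_add]
    ring_nf
  have hB : 0 < A := Real.exp_pos _
  calc _ ≤ A * (‖U‖ + ‖V‖) := hUV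
    _ ≤ A * (Real.exp (l ^ 2 * σ ^ 2) * (B * ‖hg.toLp g‖) +
          Real.exp ((-l) ^ 2 * σ ^ 2) * (B * ‖hg.toLp g‖)) := by
        gcongr
        · exact hU.trans (by gcongr)
        · exact hV.trans (by gcongr)
    _ = M * ‖hg.toLp g‖ := by rw [hAB, neg_sq]; ring

end Fourier

theorem IsMulBy.norm_le_mul {c : ℝ → ℝ} {X : L2 →L[ℂ] L2} (hX : IsMulBy c X) {M : ℝ}
    (hM : ∀ x, |c x| ≤ M) (f : L2) : ‖X f‖ ≤ M * ‖f‖ := by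
  refine Lp.norm_le_mul_norm_of_ae_le_mul ?_
  filter_upwards [hX f] with x hx
  rw [hx, norm_mul, Complex.norm_real]
  exact mul_le_mul_of_nonneg_right (hM x) (norm_nonneg _)

theorem IsMulBy.one_sub {c : ℝ → ℝ} {X : L2 →L[ℂ] L2} (hX : IsMulBy c X) :
    IsMulBy (fun x => 1 - c x) (1 - X) := fun f => by
  rw [sub_apply, one_apply_eq_self]
  filter_upwards [Lp.coeFn_sub f (X f), hX f] with x h1 h2
  rw [h1, Pi.sub_apply, h2]
  push_cast
  ring

theorem IsMulBy.comp {c d : ℝ → ℝ} {X Y : L2 →L[ℂ] L2} (hX : IsMulBy c X) (hY : IsMulBy d Y) :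
    IsMulBy (fun x => c x * d x) (X ∘L Y) := fun f => by
  filter_upwards [hX (Y f), hY f] with x h1 h2
  rw [ContinuousLinearMap.comp_apply, h1, h2]
  push_cast
  ring

theorem IsMulBy.inner_left {c : ℝ → ℝ} {X : L2 →L[ℂ] L2} (hX : IsMulBy c X) (f g : L2) :
    inner ℂ (X f) g = inner ℂ f (X g) := by
  rw [L2.inner_def, L2.inner_def]
  refine integral_congr_ae ?_
  filter_upwards [hX f, hX g] with x h1 h2
  rw [h1, h2, ← smul_eq_mul, ← smul_eq_mul, inner_smul_left, inner_smul_right, Complex.conj_ofReal]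

theorem norm_le_of_sq_norm_le_re_inner {f g : L2} (h : ‖g‖ ^ 2 ≤ (inner ℂ g f).re) : ‖g‖ ≤ ‖f‖ := by
  have h1 : ‖g‖ * ‖g‖ ≤ ‖g‖ * ‖f‖ := by
    rw [← sq]
    exact h.trans (re_inner_le_norm (𝕜 := ℂ) g f)
  rcases (norm_nonneg g).eq_or_lt with h0 | h0
  · rw [← h0]
    exact norm_nonneg f
  · exact le_of_mul_le_mul_left h1 h0

theorem norm_sub_conj_le {X Q : L2 →L[ℂ] L2} (hX : ∀ f, ‖X f‖ ≤ ‖f‖)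
    (hXs : ∀ f g, inner ℂ (X f) g = inner ℂ f (X g))
    (hQ : ∀ f, ‖Q f‖ ^ 2 ≤ (inner ℂ (Q f) f).re) (f : L2) : ‖f - X (Q (X f))‖ ≤ ‖f‖ := by
  have h1 : ‖X (Q (X f))‖ ^ 2 ≤ (inner ℂ f (X (Q (X f)))).re := by
    rw [← hXs, ← RCLike.re_eq_complex_re, inner_re_symm]
    exact (pow_le_pow_left₀ (norm_nonneg _) (hX _) 2).trans (hQ (X f))
  have h2 := norm_sub_sq (𝕜 := ℂ) f (X (Q (X f)))
  rw [RCLike.re_eq_complex_re] at h2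
  refine pow_le_pow_iff_left₀ (norm_nonneg _) (norm_nonneg _) two_ne_zero |>.1 ?_
  linarith [sq_nonneg ‖X (Q (X f))‖]

theorem norm_localization_defect_le {X P : L2 →L[ℂ] L2} (hX : ∀ f, ‖X f‖ ≤ ‖f‖)
    (hQ : ∀ f, ‖(1 - P) f‖ ≤ ‖f‖) (f : L2) :
    ‖(1 - P) f - X ((1 - P) (X f))‖ ≤ 2 * ‖(1 - X) f‖ + ‖(1 - X) (P f)‖ := by
  have e : (1 - P) f - X ((1 - P) (X f)) =
      X ((1 - P) ((1 - X) f)) + (1 - X) f - (1 - X) (P f) := by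
    simp only [sub_apply, one_apply_eq_self, map_sub]
    abel
  rw [e]
  have h1 := (hX _).trans (hQ ((1 - X) f))
  have h2 := norm_sub_le (X ((1 - P) ((1 - X) f)) + (1 - X) f) ((1 - X) (P f))
  have h3 := norm_add_le (X ((1 - P) ((1 - X) f))) ((1 - X) f)
  linarith

theorem IsMulBy.norm_le {L σ : ℝ} (hL : 0 ≤ L) (hσ : 0 < σ) {X : L2 →L[ℂ] L2}
    (hX : IsMulBy (chi0 L σ) X) (f : L2) : ‖X f‖ ≤ ‖f‖ := by
  have h := hX.norm_le_mul (M := 1)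
    (fun x => by rw [abs_of_nonneg (chi0_nonneg hL hσ x)]; exact chi0_le_one _ _ _) f
  rwa [one_mul] at h

theorem norm_localization_defect_mul_le {kmax σ L L' σ' c : ℝ} (hk : 0 ≤ kmax) (hσ : 0 < σ)
    (hL' : 0 ≤ L') (hσ' : 0 < σ') (hσσ' : σ' ≤ σ / 2) (hc : 1 ≤ c) (hLL' : 4 * c * σ ≤ L - L')
    {X Y P : L2 →L[ℂ] L2} (hX : IsMulBy (chi0 L σ) X) (hY : IsMulBy (chi0 L' σ') Y)
    (hP : IsMultOp (P0fun kmax σ) P) (f : L2) :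
    ‖(1 - P) (Y f) - X ((1 - P) (X (Y f)))‖ ≤ 3 * erfc' c * ‖f‖ := by
  have hL : 0 ≤ L := by
    have : 0 ≤ 4 * c * σ := by positivity
    linarith
  have hexp : ∀ a b : ℝ, 0 ≤ a → 0 ≤ b →
      -3 * (a * c / σ) * (L - L') / 4 + (a * c / σ) ^ 2 * (b * σ ^ 2 + σ' ^ 2) / 4 ≤
        (-3 * a + a ^ 2 * (b + 1 / 4) / 4) * c ^ 2 := fun a b ha hb => by
    have h1 : a * c / σ * (4 * c * σ) ≤ a * c / σ * (L - L') := by gcongr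
    have h2 : (a * c / σ) ^ 2 * (b * σ ^ 2 + σ' ^ 2) ≤
        (a * c / σ) ^ 2 * (b * σ ^ 2 + (σ / 2) ^ 2) := by gcongr
    have e1 : a * c / σ * (4 * c * σ) = 4 * a * c ^ 2 := by field_simp
    have e2 : (a * c / σ) ^ 2 * (b * σ ^ 2 + (σ / 2) ^ 2) = a ^ 2 * (b + 1 / 4) * c ^ 2 := by
      field_simp
      ring
    rw [e1] at h1
    rw [e2] at h2
    linarith
  have h1 : ‖(1 - X) (Y f)‖ ≤ 2 * Real.exp (-7 * c ^ 2) * ‖f‖ := by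
    refine (hX.one_sub.comp hY).norm_le_mul (fun x => ?_) f
    rw [abs_of_nonneg (mul_nonneg (sub_nonneg.2 (chi0_le_one _ _ _)) (chi0_nonneg hL' hσ' x))]
    refine (one_sub_chi0_mul_chi0_le (l := 4 * c / σ) hL' hσ hσ' (by positivity) x).trans ?_
    gcongr
    have := hexp 4 1 (by norm_num) (by norm_num)
    rw [one_mul] at this
    exact this.trans_eq (by ring)
  have h2 : ‖(1 - X) (P (Y f))‖ ≤ 2 * Real.exp (-(27 / 16) * c ^ 2) * ‖f‖ := by
    refine (norm_one_sub_mul_multOp_mul_le (l := c / σ) hk hσ hL' hσ' (by positivity) hP hX hY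
      f).trans ?_
    gcongr
    have := hexp 1 5 (by norm_num) (by norm_num)
    rw [one_mul] at this
    exact this.trans_eq (by ring)
  have h3 := norm_localization_defect_le (P := P) (hX.norm_le hL hσ) (fun g =>
    norm_le_of_sq_norm_le_re_inner (hP.sq_norm_one_sub_le (continuous_P0fun _ _)
      (P0fun_nonneg hk hσ) (P0fun_le_one _ hσ) g)) (Y f)
  have h4 := mul_le_mul_of_nonneg_right (exp_bound_le_erfc' hc) (norm_nonneg f)
  linarith

theorem norm_multiscale_remainder_le {X Q : ℕ → L2 →L[ℂ] L2} (hX : ∀ m f, ‖X m f‖ ≤ ‖f‖)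
    (hXs : ∀ m f g, inner ℂ (X m f) g = inner ℂ f (X m g))
    (hQ : ∀ m f, ‖Q m f‖ ^ 2 ≤ (inner ℂ (Q m f) f).re) {f : L2} {fm : ℕ → L2}
    (h0 : fm 0 = f - X 0 (Q 0 (X 0 f)))
    (hS : ∀ m, fm (m + 1) = fm m - X (m + 1) (Q (m + 1) (X (m + 1) (fm m)))) (n : ℕ) :
    ‖fm n‖ ≤ ‖f‖ := by
  induction n with
  | zero => rw [h0]; exact norm_sub_conj_le (hX 0) (hXs 0) (hQ 0) f
  | succ n ih =>
    rw [hS]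
    exact (norm_sub_conj_le (hX _) (hXs _) (hQ _) _).trans ih

theorem norm_apply_multiscale_remainder_le {X Q : ℕ → L2 →L[ℂ] L2} (hX : ∀ m f, ‖X m f‖ ≤ ‖f‖)
    (hXs : ∀ m f g, inner ℂ (X m f) g = inner ℂ f (X m g))
    (hQ : ∀ m f, ‖Q m f‖ ^ 2 ≤ (inner ℂ (Q m f) f).re) {f : L2} {fm : ℕ → L2}
    (h0 : fm 0 = f - X 0 (Q 0 (X 0 f)))
    (hS : ∀ m, fm (m + 1) = fm m - X (m + 1) (Q (m + 1) (X (m + 1) (fm m))))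
    {D : L2 →L[ℂ] L2} {a b : ℝ} {m : ℕ} (hb : 0 ≤ b) (hDf : ‖D f‖ ≤ a)
    (hD : ∀ j < m, ∀ g, ‖D (X j g)‖ ≤ b * ‖g‖) (n : ℕ) (hn : n < m) :
    ‖D (fm n)‖ ≤ a + (n + 1) * (b * ‖f‖) := by
  have hstep : ∀ j < m, ∀ g, ‖g‖ ≤ ‖f‖ → ‖D (X j (Q j (X j g)))‖ ≤ b * ‖f‖ := fun j hj g hg =>
    (hD j hj _).trans (mul_le_mul_of_nonneg_left
      (((norm_le_of_sq_norm_le_re_inner (hQ j _)).trans (hX j g)).trans hg) hb)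
  induction n with
  | zero =>
    rw [h0, map_sub]
    have := hstep 0 hn f le_rfl
    have h1 := norm_sub_le (D f) (D (X 0 (Q 0 (X 0 f))))
    push_cast
    linarith
  | succ n ih =>
    rw [hS, map_sub]
    have h1 := ih (by omega)
    have h2 := hstep (n + 1) hn (fm n) (norm_multiscale_remainder_le hX hXs hQ h0 hS n)
    have h3 := norm_sub_le (D (fm n)) (D (X (n + 1) (Q (n + 1) (X (n + 1) (fm n)))))
    push_cast
    linarith

/-- Proposition: ‖f⁻ₘ − Pₘ f⁻ₘ₋₁‖ ≤ (m+2)(3 + 15·kmax/(4·2^m))·δ₁·‖f‖ for m ≥ 1. -/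
theorem stmt2 (L kmax σ δ₁ : ℝ) (hL : 0 < L) (hk : 0 < kmax) (hσ : 0 < σ)
    (hδpos : 0 < δ₁) (hδle : δ₁ ≤ erfc' 1)
    (hσlo : 8 * erfcInv δ₁ / kmax ≤ σ) (hσhi : σ ≤ L / (8 * erfcInv δ₁))
    (X P : ℕ → (L2 →L[ℂ] L2))
    (hX : ∀ m, IsMulBy (chiSc L σ m) (X m)) (hP : ∀ m, IsMultOp (PSc kmax σ m) (P m))
    (f : L2)
    -- f is phase-space localized with tolerance δ₁:
    (hloc : ∀ m, ‖(1 - P m) f - X m ((1 - P m) (X m f))‖ ≤ δ₁ * ‖f‖)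
    -- the recursive multiscale decomposition f⁺ₘ, f⁻ₘ:
    (fp fm : ℕ → L2)
    (hfp0 : fp 0 = X 0 ((1 - P 0) (X 0 f)))
    (hfm0 : fm 0 = f - fp 0)
    (hfpS : ∀ m, fp (m+1) = X (m+1) ((1 - P (m+1)) (X (m+1) (fm m))))
    (hfmS : ∀ m, fm (m+1) = fm m - fp (m+1))
    (m : ℕ) (hm : 1 ≤ m) :
    ‖fm m - P m (fm (m-1))‖ ≤ ((m : ℝ) + 2) * (3 + 15 * kmax / (4 * 2^m)) * δ₁ * ‖f‖ := by
  have hδ1 : δ₁ ≤ 1 := hδle.trans erfc'_one_le_one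
  have hc := one_le_erfcInv hδpos hδle
  have hcδ := erfc'_erfcInv hδpos hδ1
  set c := erfcInv δ₁
  have hLc : 8 * c * σ ≤ L := by
    rw [le_div_iff₀ (by positivity)] at hσhi
    linarith
  have hσm : ∀ m : ℕ, 0 < 2 ^ m * σ := fun m => by positivity
  have hLm : ∀ m : ℕ, 0 ≤ 2 ^ m * L := fun m => by positivity
  have hkm : ∀ m : ℕ, 0 ≤ kmax / 2 ^ m := fun m => by positivity
  have hX' : ∀ m, IsMulBy (chi0 (2 ^ m * L) (2 ^ m * σ)) (X m) := fun m =>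
    chiSc_eq L σ m ▸ hX m
  have hP' : ∀ m, IsMultOp (P0fun (kmax / 2 ^ m) (2 ^ m * σ)) (P m) := fun m =>
    PSc_eq kmax σ m ▸ hP m
  have hXn : ∀ m f, ‖X m f‖ ≤ ‖f‖ := fun m => (hX' m).norm_le (hLm m) (hσm m)
  have hQ : ∀ m f, ‖(1 - P m) f‖ ^ 2 ≤ (inner ℂ ((1 - P m) f) f).re := fun m =>
    (hP' m).sq_norm_one_sub_le (continuous_P0fun _ _) (P0fun_nonneg (hkm m) (hσm m))
      (P0fun_le_one _ (hσm m))
  obtain ⟨n, rfl⟩ : ∃ n, m = n + 1 := ⟨m - 1, by omega⟩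
  let D : L2 →L[ℂ] L2 := (1 - P (n + 1)) - X (n + 1) ∘L (1 - P (n + 1)) ∘L X (n + 1)
  have hD : ∀ j < n + 1, ∀ g, ‖D (X j g)‖ ≤ 3 * δ₁ * ‖g‖ := fun j hj g => by
    have hpow : (2 : ℝ) ^ j ≤ 2 ^ n := pow_le_pow_right₀ one_le_two (by omega)
    rw [← hcδ]
    refine norm_localization_defect_mul_le (hkm (n + 1)) (hσm _) (hLm j) (hσm j) ?_ hc ?_
      (hX' _) (hX' j) (hP' _) g
    · rw [pow_succ]
      nlinarith
    · have h1 : (2 : ℝ) ^ j * L ≤ 2 ^ n * L := by gcongr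
      have h2 : (2 : ℝ) ^ n * (8 * c * σ) ≤ 2 ^ n * L := by gcongr
      rw [pow_succ]
      linarith
  have key := norm_apply_multiscale_remainder_le (Q := fun m => 1 - P m) (fm := fm) hXn
    (fun m => (hX' m).inner_left) hQ (by rw [hfm0, hfp0])
    (fun m => by rw [hfmS, hfpS]) (D := D) (m := n + 1) (by positivity) (hloc (n + 1)) hD n
    (Nat.lt_succ_self n)
  have e : fm (n + 1) - P (n + 1) (fm (n + 1 - 1)) = D (fm n) := by
    rw [Nat.add_sub_cancel, hfmS, hfpS]
    simp only [D, sub_apply, one_apply_eq_self, ContinuousLinearMap.comp_apply, map_sub]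
    abel
  rw [e]
  refine key.trans ?_
  have h3 : 0 ≤ 15 * kmax / (4 * 2 ^ (n + 1)) := by positivity
  have h4 : 0 ≤ δ₁ * ‖f‖ := by positivity
  calc _ = (3 * n + 4) * (δ₁ * ‖f‖) := by ring
    _ ≤ (((n + 1 : ℕ) : ℝ) + 2) * (3 + 15 * kmax / (4 * 2 ^ (n + 1))) * (δ₁ * ‖f‖) := by
        gcongr
        push_cast
        nlinarith [(Nat.cast_nonneg n : (0 : ℝ) ≤ n)]
    _ = _ := by ring

end
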